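/- For every complex character χ of G, ⟨χ|_{H₂}, θ₂⟩ + 2⟨χ|_{H₃}, θ₃⟩ + Σ_{k=1}^{6} ⟨χ|_{H₇}, θ₇^k⟩ = 2·Γ(χ); that is, the equivariant degree of the ramification divisor R of a Hurwitz curve with automorphism group G satisfies deg_eq(R) = 2·Γ̃_G. -/

import Mathlib

open scoped BigOperators Classical

noncomputable section

/-- The projective special linear group `PSL(2, F) = SL(2, F)/{±I}` (for `F` a finite
field of odd characteristic the center of `SL(2,F)` is exactly `{±I}`). -/
abbrev PSL2 (F : Type) [Field F] : Type :=
  Matrix.SpecialLinearGroup (Fin 2) F ⧸ Subgroup.center (Matrix.SpecialLinearGroup (Fin 2) F)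

/-- `χ` is the character of some finite-dimensional complex representation of `G`. -/
def IsCharacter (G : Type) [Group G] (χ : G → ℂ) : Prop :=
  ∃ V : FDRep ℂ G, V.character = χ

/-- `χ` is an irreducible complex character of `G`. -/
def IsIrrCharacter (G : Type) [Group G] (χ : G → ℂ) : Prop :=
  ∃ V : FDRep ℂ G, CategoryTheory.Simple V ∧ V.character = χ

/-- `⟨χ|_H, θ⟩ = (1/|H|) ∑_{h ∈ H} χ(h) θ(h)⁻¹`, the multiplicity of the linear
character `θ` of `H` in the restriction `χ|_H`. -/
def restMult {G : Type} [Group G] [Finite G] (H : Subgroup G) (θ : H →* ℂˣ) (χ : G → ℂ) : ℂ :=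
  letI : Fintype H := Fintype.ofFinite H
  (Nat.card H : ℂ)⁻¹ * ∑ h : H, χ h * ((θ h : ℂ))⁻¹

/-- `dim χ^H = (1/|H|) ∑_{h ∈ H} χ(h)`, the dimension of the `H`-fixed subspace. -/
def dimFixed {G : Type} [Group G] [Finite G] (H : Subgroup G) (χ : G → ℂ) : ℂ :=
  letI : Fintype H := Fintype.ofFinite H
  (Nat.card H : ℂ)⁻¹ * ∑ h : H, χ h

/-- The ramification multiplicity
`Γ(χ) = (1/2)⟨χ|_{H₂},θ₂⟩ + (1/3)(⟨χ|_{H₃},θ₃⟩ + 2⟨χ|_{H₃},θ₃²⟩)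
  + (1/7)∑_{k=1}^{6} k ⟨χ|_{H₇},θ₇^k⟩`. -/
def ramMult {G : Type} [Group G] [Finite G] (H2 H3 H7 : Subgroup G)
    (θ2 : H2 →* ℂˣ) (θ3 : H3 →* ℂˣ) (θ7 : H7 →* ℂˣ) (χ : G → ℂ) : ℂ :=
  (1/2) * restMult H2 θ2 χ
    + (1/3) * (restMult H3 θ3 χ + 2 * restMult H3 (θ3 ^ 2) χ)
    + (1/7) * ∑ k ∈ Finset.Icc (1:ℕ) 6, (k : ℂ) * restMult H7 (θ7 ^ k) χ

/-- The base multiplicity `m = (q−ε₂)/4 + (q−ε₃)/3 + 3(q−ε₇)/7`, where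
`ε_ℓ = 1` if `q ≡ 1 (mod ℓ')` and `ε_ℓ = −1` otherwise. -/
def baseMult (q : ℕ) : ℤ :=
  ((q : ℤ) - (if q % 4 = 1 then 1 else -1)) / 4
    + ((q : ℤ) - (if q % 3 = 1 then 1 else -1)) / 3
    + 3 * (((q : ℤ) - (if q % 7 = 1 then 1 else -1)) / 7)

end

/-- Over a finite field of odd characteristic, the norm form `u² - D y²` represents `-4`. -/
lemma exists_sq_sub_mul_sq_eq_neg_four {F : Type*} [Field F] [Fintype F] (h2 : (2 : F) ≠ 0)
    {D : F} (hD : D ≠ 0) : ∃ u y : F, u ^ 2 - D * y ^ 2 = -4 := by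
  have hcard : Fintype.card F % 2 = 1 := FiniteField.odd_card_of_char_ne_two fun h => by
    have := CharP.cast_eq_zero F (ringChar F)
    rw [h] at this
    exact h2 (by exact_mod_cast this)
  obtain ⟨u, y, h⟩ := FiniteField.exists_root_sum_quadratic
    (f := Polynomial.C 1 * Polynomial.X ^ 2 + Polynomial.C 0 * Polynomial.X + Polynomial.C 4)
    (g := Polynomial.C (-D) * Polynomial.X ^ 2 + Polynomial.C 0 * Polynomial.X + Polynomial.C 0)
    (Polynomial.degree_quadratic one_ne_zero)
    (Polynomial.degree_quadratic (neg_ne_zero.mpr hD)) hcard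
  refine ⟨u, y, ?_⟩
  simp at h
  linear_combination h

/-- A traceless `!![x, y; z, -x]` of determinant one which is orthogonal to `A` for the trace form
conjugates `A` to its inverse. -/
lemma isConj_inv_of_traceless {F : Type*} [Field F] (A : Matrix.SpecialLinearGroup (Fin 2) F)
    {x y z : F} (hdet : -(x * x) - y * z = 1)
    (horth : (A 0 0 - A 1 1) * x + A 1 0 * y + A 0 1 * z = 0) : IsConj A A⁻¹ := by
  let B : Matrix.SpecialLinearGroup (Fin 2) F :=
    ⟨!![x, y; z, -x], by rw [Matrix.det_fin_two_of]; linear_combination hdet⟩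
  have hB : (B : Matrix (Fin 2) (Fin 2) F) = !![x, y; z, -x] := rfl
  refine isConj_iff.mpr ⟨B, mul_inv_eq_iff_eq_mul.mpr ?_⟩
  ext i j
  rw [Matrix.SpecialLinearGroup.coe_mul, Matrix.SpecialLinearGroup.coe_mul,
    Matrix.SpecialLinearGroup.coe_inv, Matrix.adjugate_fin_two, hB]
  fin_cases i <;> fin_cases j <;> simp [Matrix.mul_apply, Fin.sum_univ_two] <;>
    first | linear_combination horth | ring

/-- Over a finite field of odd characteristic, elements of `SL₂` with nonzero discriminant are
real. -/
lemma isConj_inv_of_discr_ne_zero {F : Type*} [Field F] [Fintype F] (h2 : (2 : F) ≠ 0)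
    (A : Matrix.SpecialLinearGroup (Fin 2) F)
    (hD : (A 0 0 - A 1 1) ^ 2 + 4 * A 0 1 * A 1 0 ≠ 0) : IsConj A A⁻¹ := by
  obtain ⟨u, v, huv⟩ := exists_sq_sub_mul_sq_eq_neg_four h2 hD
  by_cases hb : A 0 1 = 0
  · by_cases hc : A 1 0 = 0
    · exact isConj_inv_of_traceless A (x := 0) (y := 1) (z := -1) (by ring) (by rw [hb, hc]; ring)
    · refine isConj_inv_of_traceless A (x := (u + (A 0 0 - A 1 1) * v) / 2)
        (y := -((A 0 0 - A 1 1) * ((u + (A 0 0 - A 1 1) * v) / 2) + A 0 1 * (A 1 0 * v)) / A 1 0)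
        (z := A 1 0 * v) ?_ ?_
      · field_simp
        linear_combination -huv
      · field_simp
        ring
  · refine isConj_inv_of_traceless A (x := (u + (A 0 0 - A 1 1) * v) / 2) (y := A 0 1 * v)
      (z := -((A 0 0 - A 1 1) * ((u + (A 0 0 - A 1 1) * v) / 2) + A 1 0 * (A 0 1 * v)) / A 0 1)
      ?_ ?_
    · field_simp
      linear_combination -huv
    · field_simp
      ring

/-- An element of `SL₂` over a finite field of odd characteristic with zero discriminant is
unipotent up to scalars, so its `|F|`-th power is central. -/
lemma pow_card_mem_center_of_discr_eq_zero {F : Type*} [Field F] [Fintype F] (h2 : (2 : F) ≠ 0)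
    (A : Matrix.SpecialLinearGroup (Fin 2) F)
    (hD : (A 0 0 - A 1 1) ^ 2 + 4 * A 0 1 * A 1 0 = 0) :
    A ^ Fintype.card F ∈ Subgroup.center (Matrix.SpecialLinearGroup (Fin 2) F) := by
  obtain ⟨p, hp⟩ := CharP.exists F
  obtain ⟨n, hprime, hcard⟩ := FiniteField.card F p
  have : Fact p.Prime := ⟨hprime⟩
  set t : F := (A 0 0 + A 1 1) / 2 with ht
  have hsq : ((A : Matrix (Fin 2) (Fin 2) F) - Matrix.scalar (Fin 2) t) ^ 2 = 0 := by
    ext i j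
    rw [sq]
    fin_cases i <;> fin_cases j <;>
      simp [Matrix.mul_apply, Fin.sum_univ_two, ht] <;> field_simp <;>
      first | linear_combination hD | ring
  have hcomm : Commute (A : Matrix (Fin 2) (Fin 2) F) (Matrix.scalar (Fin 2) t) :=
    (Matrix.scalar_commute t (fun r => Commute.all t r) _).symm
  have hpow : (A : Matrix (Fin 2) (Fin 2) F) ^ Fintype.card F
      = Matrix.scalar (Fin 2) (t ^ Fintype.card F) := by
    have h := sub_pow_char_pow_of_commute (p := p) (n := n) hcomm
    rw [← hcard, pow_eq_zero_of_le (Fintype.one_lt_card (α := F)) hsq, ← map_pow] at h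
    exact (sub_eq_zero.mp h.symm)
  refine Subgroup.mem_center_iff.mpr fun g => Subtype.ext ?_
  rw [Matrix.SpecialLinearGroup.coe_mul, Matrix.SpecialLinearGroup.coe_mul,
    Matrix.SpecialLinearGroup.coe_pow, hpow]
  exact (Matrix.scalar_commute _ (fun r => Commute.all _ r) _).symm.eq

/-- Over a finite field of odd characteristic, elements of `PSL₂` of order prime to the
characteristic are real. -/
lemma PSL2.isConj_inv_of_pow_eq_one {F : Type} [Field F] [Fintype F] (h2 : (2 : F) ≠ 0) {n : ℕ}
    (hn : (Fintype.card F).Coprime n) (g : PSL2 F) (hg : g ^ n = 1) : IsConj g g⁻¹ := by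
  obtain ⟨A, rfl⟩ := QuotientGroup.mk_surjective g
  by_cases hD : (A 0 0 - A 1 1) ^ 2 + 4 * A 0 1 * A 1 0 = 0
  · have hq : (QuotientGroup.mk A : PSL2 F) ^ Fintype.card F = 1 := by
      rw [← QuotientGroup.mk_pow]
      exact (QuotientGroup.eq_one_iff _).mpr (pow_card_mem_center_of_discr_eq_zero h2 A hD)
    have h1 : (QuotientGroup.mk A : PSL2 F) = 1 := by
      have h := pow_gcd_eq_one.mpr ⟨hq, hg⟩
      rwa [hn, pow_one] at h
    rw [h1, inv_one]
  · exact (QuotientGroup.mk' _).map_isConj (isConj_inv_of_discr_ne_zero h2 A hD)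

lemma IsCharacter.apply_eq_of_isConj {G : Type} [Group G] {χ : G → ℂ} (hχ : IsCharacter G χ)
    {g h : G} (hgh : IsConj g h) : χ h = χ g := by
  obtain ⟨V, rfl⟩ := hχ
  obtain ⟨c, rfl⟩ := isConj_iff.mp hgh
  exact V.char_conj g c

lemma restMult_inv {G : Type} [Group G] [Finite G] (H : Subgroup G) (θ : H →* ℂˣ) (χ : G → ℂ)
    (hχ : ∀ h : H, χ (h : G)⁻¹ = χ h) : restMult H θ⁻¹ χ = restMult H θ χ := by
  unfold restMult
  let : Fintype H := Fintype.ofFinite H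
  congr 1
  refine Fintype.sum_equiv (Equiv.inv H) _ _ fun h => ?_
  simp [hχ]

/-- If `χ` is real on `H`, the multiplicities of `θ ^ i` and `θ ^ j` agree when
`i + j = |H|`. -/
lemma restMult_pow_eq_of_add_eq_card {G : Type} [Group G] [Finite G] (H : Subgroup G)
    (θ : H →* ℂˣ) (χ : G → ℂ) (hχ : ∀ h : H, χ (h : G)⁻¹ = χ h) {i j : ℕ}
    (hij : i + j = Nat.card H) : restMult H (θ ^ i) χ = restMult H (θ ^ j) χ := by
  have h : θ ^ i = (θ ^ j)⁻¹ := by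
    refine MonoidHom.ext fun x => ?_
    rw [MonoidHom.inv_apply, MonoidHom.pow_apply, MonoidHom.pow_apply, eq_inv_iff_mul_eq_one,
      ← pow_add, hij, ← map_pow, pow_card_eq_one', map_one]
  rw [h, restMult_inv H _ χ hχ]

theorem equivariant_degree_ramification_divisor
    (q : ℕ) (hq : IsPrimePow q) (hgcd : Nat.Coprime q 42)
    (hq7 : q % 7 = 1 ∨ q % 7 = 6)
    (F : Type) [Field F] [Fintype F] (hF : Fintype.card F = q)
    (H2 H3 H7 : Subgroup (PSL2 F))
    (hH2 : Nat.card H2 = 2) (hH3 : Nat.card H3 = 3) (hH7 : Nat.card H7 = 7)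
    (θ2 : H2 →* ℂˣ) (θ3 : H3 →* ℂˣ) (θ7 : H7 →* ℂˣ)
    (hθ2 : Function.Injective θ2) (hθ3 : Function.Injective θ3)
    (hθ7 : Function.Injective θ7)
    (χ : PSL2 F → ℂ) (hχ : IsCharacter (PSL2 F) χ)
    :
    restMult H2 θ2 χ + 2 * restMult H3 θ3 χ
      + ∑ k ∈ Finset.Icc (1:ℕ) 6, restMult H7 (θ7 ^ k) χ
      = 2 * ramMult H2 H3 H7 θ2 θ3 θ7 χ := by
  have hne2 : (2 : F) ≠ 0 := by
    intro h
    obtain ⟨p, hp⟩ := CharP.exists F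
    obtain ⟨n, hprime, hcard⟩ := FiniteField.card F p
    have hp2 : p ∣ 2 := (CharP.cast_eq_zero_iff F p 2).mp (by exact_mod_cast h)
    have hpq : p ∣ q := hF ▸ hcard ▸ dvd_pow_self p n.ne_zero
    exact hprime.one_lt.ne' (Nat.dvd_one.mp
      (hgcd ▸ Nat.dvd_gcd hpq (hp2.trans (by norm_num))))
  have hreal (H : Subgroup (PSL2 F)) (hH : Nat.card H ∣ 42) (h : H) :
      χ (h : PSL2 F)⁻¹ = χ h := by
    refine hχ.apply_eq_of_isConj (PSL2.isConj_inv_of_pow_eq_one hne2 (n := Nat.card H)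
      (hF ▸ hgcd.coprime_dvd_right hH) _ ?_)
    exact_mod_cast congrArg Subtype.val (pow_card_eq_one' (x := h))
  have h3 : restMult H3 (θ3 ^ 2) χ = restMult H3 θ3 χ := by
    rw [restMult_pow_eq_of_add_eq_card H3 θ3 χ (hreal H3 (by rw [hH3]; norm_num))
      (i := 2) (j := 1) (by rw [hH3]), show θ3 ^ 1 = θ3 from pow_one θ3]
  have h7 {i j : ℕ} (hij : i + j = 7) : restMult H7 (θ7 ^ i) χ = restMult H7 (θ7 ^ j) χ :=
    restMult_pow_eq_of_add_eq_card H7 θ7 χ (hreal H7 (by rw [hH7]; norm_num)) (by rw [hH7, hij])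
  have hIcc : Finset.Icc 1 6 = ({1, 2, 3, 4, 5, 6} : Finset ℕ) := by decide
  simp only [ramMult, hIcc, h3]
  simp [h7 (i := 4) (j := 3) rfl, h7 (i := 5) (j := 2) rfl, h7 (i := 6) (j := 1) rfl]
  ring
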